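/- Liebmann–Blaschke–Weyl infinitesimal rigidity: let φ : 𝕊² → ℝ³ be a smooth embedding, ν a unit normal field for φ, and assume φ has everywhere positive Gauss curvature with respect to ν. Then every isometric infinitesimal deformation ξ of φ is trivial: there exist vectors a, b ∈ ℝ³ such that ξ x = a × φ x + b for all x ∈ 𝕊². -/

import Mathlib

noncomputable section

open scoped Manifold RealInnerProductSpace
open Metric Module

local notation "ℝ³" => EuclideanSpace ℝ (Fin 3)

instance : Fact (finrank ℝ ℝ³ = 2 + 1) := ⟨by simp⟩

local notation "𝕊²" => sphere (0 : ℝ³) 1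

/-- The cross product on `ℝ³ = EuclideanSpace ℝ (Fin 3)`. -/
def cross (a b : ℝ³) : ℝ³ :=
  (EuclideanSpace.equiv (Fin 3) ℝ).symm
    (crossProduct (EuclideanSpace.equiv (Fin 3) ℝ a) (EuclideanSpace.equiv (Fin 3) ℝ b))

/-- `f : 𝕊² → ℝ³` is smooth (`C^∞`). -/
def Smooth3 (f : 𝕊² → ℝ³) : Prop := ContMDiff (𝓡 2) 𝓘(ℝ, ℝ³) (⊤ : ℕ∞) f

/-- The manifold derivative of `f : 𝕊² → ℝ³` at `x ∈ 𝕊²`. -/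
def mfd (f : 𝕊² → ℝ³) (x : 𝕊²) : TangentSpace (𝓡 2) x →L[ℝ] ℝ³ :=
  mfderiv (𝓡 2) 𝓘(ℝ, ℝ³) f x

/-- `ν` is a unit normal field for `φ`. -/
def IsUnitNormalField (φ ν : 𝕊² → ℝ³) : Prop :=
  Smooth3 ν ∧ (∀ x, ‖ν x‖ = 1) ∧
    ∀ (x : 𝕊²) (X : TangentSpace (𝓡 2) x), ⟪ν x, mfd φ x X⟫ = 0

/-- `φ` has everywhere positive Gauss curvature with respect to `ν`. -/
def PosGaussCurvature (φ ν : 𝕊² → ℝ³) : Prop :=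
  ∀ (x : 𝕊²) (X Y : TangentSpace (𝓡 2) x), LinearIndependent ℝ ![X, Y] →
    0 < ⟪cross (mfd ν x X) (mfd ν x Y), cross (mfd φ x X) (mfd φ x Y)⟫

/-- `η` is an isogauss infinitesimal deformation of `φ` with respect to `ν`. -/
def IsIsogaussDeformation (φ ν η : 𝕊² → ℝ³) : Prop :=
  Smooth3 η ∧
    (∀ (x : 𝕊²) (X : TangentSpace (𝓡 2) x), ⟪mfd η x X, ν x⟫ = 0) ∧
    ∀ (x : 𝕊²) (X Y : TangentSpace (𝓡 2) x),
      cross (mfd η x X) (mfd φ x Y) + cross (mfd φ x X) (mfd η x Y) = 0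

/-- `ξ` is an isometric infinitesimal deformation of `φ`. -/
def IsIsometricDeformation (φ ξ : 𝕊² → ℝ³) : Prop :=
  Smooth3 ξ ∧
    ∀ (x : 𝕊²) (X Y : TangentSpace (𝓡 2) x),
      ⟪mfd ξ x X, mfd φ x Y⟫ + ⟪mfd φ x X, mfd ξ x Y⟫ = 0

/-- `η` is the rotation vector field of the isometric infinitesimal deformation `ξ` of `φ`. -/
def IsRotationField (φ ξ η : 𝕊² → ℝ³) : Prop :=
  Smooth3 η ∧
    ∀ (x : 𝕊²) (X : TangentSpace (𝓡 2) x), mfd ξ x X = cross (η x) (mfd φ x X)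

section Covering

lemma exists_norm_eq_one_inner_eq_zero (q : ℝ³) : ∃ v : ℝ³, ‖v‖ = 1 ∧ ⟪q, v⟫ = 0 := by
  have h2 : 2 ≤ finrank ℝ (ℝ ∙ q)ᗮ := by
    have h1 := (ℝ ∙ q).finrank_add_finrank_orthogonal
    have h3 : finrank ℝ (ℝ ∙ q) ≤ 1 := by
      simpa using finrank_span_le_card (R := ℝ) ({q} : Set ℝ³)
    have h4 : finrank ℝ ℝ³ = 3 := by simp
    omega
  have : Nontrivial (ℝ ∙ q)ᗮ := Module.nontrivial_of_finrank_pos (R := ℝ) (by omega)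
  obtain ⟨v, hv⟩ := exists_norm_eq (ℝ ∙ q)ᗮ zero_le_one
  exact ⟨v, hv, Submodule.mem_orthogonal_singleton_iff_inner_right.1 v.2⟩

lemma ne_neg_of_norm_eq_one {v : ℝ³} (hv : ‖v‖ = 1) : v ≠ -v := by
  intro h
  have h1 := congrArg (fun w => ⟪v, w⟫) h
  simp only [inner_neg_right, real_inner_self_eq_norm_sq, hv] at h1
  norm_num at h1

lemma IsCoveringMap.exists_lift_compl_pole {f : 𝕊² → 𝕊²} (hf : IsCoveringMap f) {v : ℝ³}
    (hv : ‖v‖ = 1) {a : 𝕊²} (ha : (f a : ℝ³) ≠ v) :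
    ∃ s : 𝕊² → 𝕊², ContinuousOn s {x | (x : ℝ³) ≠ v} ∧
      (∀ x : 𝕊², (x : ℝ³) ≠ v → f (s x) = x) ∧ s (f a) = a := by
  have hsrc : ∀ x : 𝕊², (x : ℝ³) ≠ v → x ∈ (stereographic hv).source := by
    intro x hx
    simpa [Subtype.ext_iff] using hx
  have hcont : Continuous (stereographic hv).symm := by
    rw [← continuousOn_univ, ← stereographic_target hv]
    exact (stereographic hv).continuousOn_symm
  obtain ⟨F, ⟨hF0, hF⟩, -⟩ := hf.existsUnique_continuousMap_lifts
    ⟨(stereographic hv).symm, hcont⟩ (stereographic hv (f a)) a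
    (by simpa using ((stereographic hv).left_inv (hsrc _ ha)).symm)
  refine ⟨F ∘ stereographic hv, ?_, ?_, ?_⟩
  · refine F.continuous.comp_continuousOn ((stereographic hv).continuousOn.mono ?_)
    exact fun x hx => hsrc x hx
  · intro x hx
    have := congrFun hF (stereographic hv x)
    simpa [(stereographic hv).left_inv (hsrc _ hx)] using this
  · simpa using hF0

lemma isPreconnected_compl_poles {v : ℝ³} (hv : ‖v‖ = 1) :
    IsPreconnected {x : 𝕊² | (x : ℝ³) ≠ v ∧ (x : ℝ³) ≠ -v} := by
  have hv0 : v ≠ 0 := by rintro rfl; simp at hv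
  have h2 : 1 < Module.rank ℝ (ℝ ∙ v)ᗮ :=
    one_lt_rank_of_one_lt_finrank (by rw [Submodule.finrank_orthogonal_span_singleton (n := 2) hv0]; exact one_lt_two)
  have hsub := (isConnected_compl_singleton_of_one_lt_rank h2 0).isPreconnected
  have himg := hsub.image _ (continuous_stereoInvFun hv).continuousOn
  have hneg : stereoToFun v (-v) = 0 := by
    rw [stereoToFun_apply, map_neg (ℝ ∙ v)ᗮ.orthogonalProjectionOnto,
      Submodule.orthogonalProjectionOnto_orthogonalComplement_singleton_eq_zero, neg_zero,
      smul_zero]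
  have heq : {x : 𝕊² | (x : ℝ³) ≠ v ∧ (x : ℝ³) ≠ -v} = stereoInvFun hv '' {0}ᶜ := by
    ext x
    constructor
    · rintro ⟨h1, h2⟩
      have hx : stereoInvFun hv (stereoToFun v x) = x := stereo_left_inv hv h1
      refine ⟨stereoToFun v x, fun h0 => h2 ?_, hx⟩
      have hn : stereoInvFun hv (stereoToFun v (-v)) = ⟨-v, by simp [hv]⟩ :=
        stereo_left_inv hv (x := ⟨-v, by simp [hv]⟩) (ne_neg_of_norm_eq_one hv).symm
      rw [← hx, Set.mem_singleton_iff.1 h0, ← hneg, hn]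
    · rintro ⟨w, hw, rfl⟩
      refine ⟨fun h => stereoInvFun_ne_north_pole hv w (Subtype.ext h), fun h => hw ?_⟩
      rw [Set.mem_singleton_iff, ← stereo_right_inv hv w, h, hneg]
  rw [heq]
  exact himg

instance : PreconnectedSpace 𝕊² :=
  Subtype.preconnectedSpace (isPreconnected_sphere (by
    rw [← finrank_eq_rank]; simp) _ _)

/-- A local homeomorphism of the two-sphere is injective. -/
theorem IsLocalHomeomorph.injective_of_sphere {f : 𝕊² → 𝕊²} (h : IsLocalHomeomorph f) :
    Function.Injective f := by
  have hf : IsCoveringMap f := isLocalHomeomorph_iff_isCoveringMap.1 h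
  suffices ∀ a : 𝕊², ∃ g : 𝕊² → 𝕊², Continuous g ∧ (∀ x, f (g x) = x) ∧ g (f a) = a by
    intro a b hab
    obtain ⟨g, hg, hfg, hga⟩ := this a
    have := hf.eq_of_comp_eq (hg.comp h.continuous) continuous_id
      (by ext x; simp [hfg]) a (by simp [hga])
    have hb := congrFun this b
    simp only [Function.comp_apply, id_eq] at hb
    rw [← hb, ← hab, hga]
  intro a
  obtain ⟨v, hv, hav⟩ := exists_norm_eq_one_inner_eq_zero (f a : ℝ³)
  have hvv : ⟪v, v⟫ = (1 : ℝ) := by simp [hv]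
  have ha1 : (f a : ℝ³) ≠ v := by rintro h; rw [h, hvv] at hav; norm_num at hav
  have ha2 : (f a : ℝ³) ≠ -v := by
    rintro h; rw [h, inner_neg_left, hvv] at hav; norm_num at hav
  have hvn : v ≠ -v := ne_neg_of_norm_eq_one hv
  obtain ⟨s, hs, hfs, hsa⟩ := hf.exists_lift_compl_pole hv ha1
  obtain ⟨t, ht, hft, hta⟩ := hf.exists_lift_compl_pole (v := -v) (by simpa using hv) ha2
  have heq : Set.EqOn s t {x : 𝕊² | (x : ℝ³) ≠ v ∧ (x : ℝ³) ≠ -v} :=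
    hf.eqOn_of_comp_eqOn (isPreconnected_compl_poles hv) (hs.mono fun x hx => hx.1)
      (ht.mono fun x hx => hx.2) (fun x hx => by simp [hfs x hx.1, hft x hx.2])
      (a := f a) ⟨ha1, ha2⟩ (by rw [hsa, hta])
  have hopen : ∀ w : ℝ³, IsOpen {x : 𝕊² | (x : ℝ³) ≠ w} := fun w =>
    isOpen_ne.preimage continuous_subtype_val
  classical
  refine ⟨fun x => if (x : ℝ³) = v then t x else s x, ?_, ?_, by simp [ha1, hsa]⟩
  · rw [continuous_iff_continuousAt]
    intro x
    by_cases hx : (x : ℝ³) = v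
    · have hx' : (x : ℝ³) ≠ -v := by rw [hx]; exact hvn
      refine (ht.continuousAt ((hopen _).mem_nhds hx')).congr ?_
      filter_upwards [(hopen _).mem_nhds hx'] with y hy
      split_ifs with hyv
      · rfl
      · exact (heq ⟨hyv, hy⟩).symm
    · refine (hs.continuousAt ((hopen _).mem_nhds hx)).congr ?_
      filter_upwards [(hopen _).mem_nhds hx] with y hy
      simp [show (y : ℝ³) ≠ v from hy]
  · intro x
    dsimp only
    split_ifs with hx
    · exact hft x (by rw [hx]; exact hvn)
    · exact hfs x hx

end Covering

section CrossProduct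

lemma cross_apply_zero (a b : ℝ³) : cross a b 0 = a 1 * b 2 - a 2 * b 1 := by
  simp [cross, crossProduct]

lemma cross_apply_one (a b : ℝ³) : cross a b 1 = a 2 * b 0 - a 0 * b 2 := by
  simp [cross, crossProduct]

lemma cross_apply_two (a b : ℝ³) : cross a b 2 = a 0 * b 1 - a 1 * b 0 := by
  simp [cross, crossProduct]

lemma inner_eq_sum_three (a b : ℝ³) : ⟪a, b⟫ = a 0 * b 0 + a 1 * b 1 + a 2 * b 2 := by
  simp [PiLp.inner_apply, Fin.sum_univ_three]
  ring

lemma ext_three {a b : ℝ³} (h0 : a 0 = b 0) (h1 : a 1 = b 1) (h2 : a 2 = b 2) : a = b := by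
  ext i
  fin_cases i <;> assumption

/-- The cross product as a continuous bilinear map. -/
def crossCLM : ℝ³ →L[ℝ] ℝ³ →L[ℝ] ℝ³ :=
  (LinearMap.toContinuousLinearMap : (ℝ³ →ₗ[ℝ] ℝ³) ≃ₗ[ℝ] ℝ³ →L[ℝ] ℝ³).toLinearMap.comp
    (LinearMap.mk₂ ℝ cross
      (fun a b c => by
        apply ext_three <;> simp only [cross_apply_zero, cross_apply_one, cross_apply_two,
          PiLp.add_apply] <;> ring)
      (fun t a b => by
        apply ext_three <;> simp only [cross_apply_zero, cross_apply_one, cross_apply_two,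
          PiLp.smul_apply, smul_eq_mul] <;> ring)
      (fun a b c => by
        apply ext_three <;> simp only [cross_apply_zero, cross_apply_one, cross_apply_two,
          PiLp.add_apply] <;> ring)
      (fun t a b => by
        apply ext_three <;> simp only [cross_apply_zero, cross_apply_one, cross_apply_two,
          PiLp.smul_apply, smul_eq_mul] <;> ring)) |>.toContinuousLinearMap

lemma crossCLM_apply (a b : ℝ³) : crossCLM a b = cross a b := by
  simp [crossCLM]

lemma cross_add_left (a b c : ℝ³) : cross (a + b) c = cross a c + cross b c := by
  simp only [← crossCLM_apply, map_add, add_apply]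

lemma cross_add_right (a b c : ℝ³) : cross a (b + c) = cross a b + cross a c := by
  simp only [← crossCLM_apply, map_add]

lemma cross_smul_left (t : ℝ) (a b : ℝ³) : cross (t • a) b = t • cross a b := by
  simp only [← crossCLM_apply, map_smul, smul_apply]

lemma cross_smul_right (t : ℝ) (a b : ℝ³) : cross a (t • b) = t • cross a b := by
  simp only [← crossCLM_apply, map_smul]

lemma cross_zero_left (a : ℝ³) : cross 0 a = 0 := by
  simp [← crossCLM_apply]

lemma cross_zero_right (a : ℝ³) : cross a 0 = 0 := by
  simp [← crossCLM_apply]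

lemma inner_cross_rotate (a b c : ℝ³) : ⟪a, cross b c⟫ = ⟪b, cross c a⟫ := by
  simp only [inner_eq_sum_three, cross_apply_zero, cross_apply_one, cross_apply_two]; ring

lemma cross_swap (a b : ℝ³) : cross a b = -cross b a := by
  apply ext_three <;> simp only [PiLp.neg_apply, cross_apply_zero, cross_apply_one,
    cross_apply_two] <;> ring

lemma inner_self_cross_right (a b : ℝ³) : ⟪b, cross a b⟫ = 0 := by
  simp only [inner_eq_sum_three, cross_apply_zero, cross_apply_one, cross_apply_two]; ring

lemma inner_cross_cross (a b c d : ℝ³) :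
    ⟪cross a b, cross c d⟫ = ⟪a, c⟫ * ⟪b, d⟫ - ⟪a, d⟫ * ⟪b, c⟫ := by
  simp only [inner_eq_sum_three, cross_apply_zero, cross_apply_one, cross_apply_two]; ring

/-- Expansion of a vector in the frame `a, b, a × b`. -/
lemma inner_cross_smul_eq (a b w : ℝ³) :
    ⟪cross a b, cross a b⟫ • w = ⟪w, cross b (cross a b)⟫ • a - ⟪w, cross a (cross a b)⟫ • b
      + ⟪w, cross a b⟫ • cross a b := by
  apply ext_three <;> simp only [PiLp.add_apply, PiLp.sub_apply, PiLp.smul_apply, smul_eq_mul,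
    inner_eq_sum_three, cross_apply_zero, cross_apply_one, cross_apply_two] <;> ring

/-- Expansion of a vector in the dual frame of `a, b, a × b`. -/
lemma inner_cross_smul_eq_dual (a b w : ℝ³) :
    ⟪cross a b, cross a b⟫ • w = ⟪w, a⟫ • cross b (cross a b) - ⟪w, b⟫ • cross a (cross a b)
      + ⟪w, cross a b⟫ • cross a b := by
  apply ext_three <;> simp only [PiLp.add_apply, PiLp.sub_apply, PiLp.smul_apply, smul_eq_mul,
    inner_eq_sum_three, cross_apply_zero, cross_apply_one, cross_apply_two] <;> ring

lemma eq_zero_of_cross_frame {a b y : ℝ³} (hn : cross a b ≠ 0) (ha : cross y a = 0)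
    (hb : cross y b = 0) : y = 0 := by
  have h := inner_cross_smul_eq a b y
  have h1 : ⟪y, cross b (cross a b)⟫ = 0 := by
    rw [inner_cross_rotate, inner_cross_rotate, hb, inner_zero_right]
  have h2 : ⟪y, cross a (cross a b)⟫ = 0 := by
    rw [inner_cross_rotate, inner_cross_rotate, ha, inner_zero_right]
  have h3 : ⟪y, cross a b⟫ = 0 := by
    rw [inner_cross_rotate, inner_cross_rotate, ha, inner_zero_right]
  rw [h1, h2, h3] at h
  simpa [hn] using h

/-- The rotation vector determined by the images `α`, `β` of two vectors `a`, `b`. -/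
def rotationVector (a b α β : ℝ³) : ℝ³ :=
  (⟪cross a b, cross a b⟫ : ℝ)⁻¹ •
    (⟪β, cross a b⟫ • a - ⟪α, cross a b⟫ • b + ⟪α, b⟫ • cross a b)

lemma cross_rotationVector {a b α β : ℝ³} (hn : cross a b ≠ 0) (hα : ⟪α, a⟫ = 0)
    (hβ : ⟪β, b⟫ = 0) (hαβ : ⟪α, b⟫ + ⟪β, a⟫ = 0) :
    cross (rotationVector a b α β) a = α ∧ cross (rotationVector a b α β) b = β := by
  have hn' : ⟪cross a b, cross a b⟫ ≠ (0 : ℝ) := by simpa using hn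
  constructor
  · rw [rotationVector, cross_smul_left, inv_smul_eq_iff₀ hn', inner_cross_smul_eq_dual a b α, hα]
    apply ext_three <;> simp only [PiLp.add_apply, PiLp.sub_apply, PiLp.smul_apply, smul_eq_mul,
      cross_apply_zero, cross_apply_one, cross_apply_two] <;> ring
  · rw [rotationVector, cross_smul_left, inv_smul_eq_iff₀ hn', inner_cross_smul_eq_dual a b β, hβ,
      eq_neg_of_add_eq_zero_left hαβ]
    apply ext_three <;> simp only [PiLp.add_apply, PiLp.sub_apply, PiLp.smul_apply, smul_eq_mul,
      cross_apply_zero, cross_apply_one, cross_apply_two] <;> ring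

/-- Every vector is a combination of `u × v`, `u` and `v` when `u × v ≠ 0`. -/
lemma exists_eq_combination {u v : ℝ³} (h : cross u v ≠ 0) (w : ℝ³) :
    ∃ c d e : ℝ, w = c • cross u v + d • u + e • v := by
  have hn' : ⟪cross u v, cross u v⟫ ≠ (0 : ℝ) := by simpa using h
  have := inner_cross_smul_eq u v w
  rw [← eq_inv_smul_iff₀ hn'] at this
  refine ⟨(⟪cross u v, cross u v⟫)⁻¹ * ⟪w, cross u v⟫,
    (⟪cross u v, cross u v⟫)⁻¹ * ⟪w, cross v (cross u v)⟫,
    -((⟪cross u v, cross u v⟫)⁻¹ * ⟪w, cross u (cross u v)⟫), ?_⟩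
  exact this.trans (by module)

lemma exists_cross_eq (x : ℝ³) : ∃ u v : ℝ³, cross u v = x := by
  obtain ⟨u, hu, hxu⟩ := exists_norm_eq_one_inner_eq_zero x
  refine ⟨u, cross x u, ?_⟩
  have h1 : ⟪u, u⟫ = (1 : ℝ) := by simp [hu]
  have h2 : cross u (cross x u) = ⟪u, u⟫ • x - ⟪x, u⟫ • u := by
    apply ext_three <;> simp only [PiLp.sub_apply, PiLp.smul_apply, smul_eq_mul,
      inner_eq_sum_three, cross_apply_zero, cross_apply_one, cross_apply_two] <;> ring
  rw [h2, h1, hxu]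
  simp

/-- The pointwise inequality behind Blaschke's integral formula. -/
lemma exists_cross_eq_neg_smul {a b c d p q : ℝ³}
    (hpos : 0 < ⟪cross p q, cross a b⟫)
    (hc : ⟪c, cross a b⟫ = 0) (hd : ⟪d, cross a b⟫ = 0)
    (hcd : cross c b = cross d a)
    (hB : ⟪a, q⟫ = ⟪b, p⟫) (hS : ⟪c, q⟫ = ⟪d, p⟫) :
    ∃ t : ℝ, 0 ≤ t ∧ cross c d = -(t • cross a b) ∧ (t = 0 → c = 0 ∧ d = 0) := by
  have hn : cross a b ≠ 0 := by rintro h; simp [h] at hpos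
  have hn' : ⟪cross a b, cross a b⟫ ≠ (0 : ℝ) := by simpa using hn
  have hexp : ∀ w : ℝ³, ⟪w, cross a b⟫ = 0 → ∃ s t : ℝ, w = s • a + t • b := by
    intro w hw
    have := inner_cross_smul_eq a b w
    rw [hw, ← eq_inv_smul_iff₀ hn'] at this
    refine ⟨(⟪cross a b, cross a b⟫)⁻¹ * ⟪w, cross b (cross a b)⟫,
      -((⟪cross a b, cross a b⟫)⁻¹ * ⟪w, cross a (cross a b)⟫), ?_⟩
    exact this.trans (by module)
  obtain ⟨c₁, c₂, rfl⟩ := hexp c hc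
  obtain ⟨d₁, d₂, rfl⟩ := hexp d hd
  have htr : (c₁ + d₂) • cross a b = 0 := by
    have e : (c₁ + d₂) • cross a b = cross (c₁ • a + c₂ • b) b - cross (d₁ • a + d₂ • b) a := by
      apply ext_three <;> simp only [PiLp.add_apply, PiLp.sub_apply, PiLp.smul_apply, smul_eq_mul,
        cross_apply_zero, cross_apply_one, cross_apply_two] <;> ring
    rw [e, hcd, sub_self]
  have hd₂ : d₂ = -c₁ := by
    have := (smul_eq_zero.1 htr).resolve_right hn
    linarith
  subst hd₂
  rw [inner_cross_cross] at hpos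
  simp only [inner_add_left, inner_smul_left, conj_trivial] at hS
  rw [real_inner_comm a p, real_inner_comm b q, real_inner_comm b p, real_inner_comm a q, hB]
    at hpos
  rw [hB] at hS
  set h₁ : ℝ := ⟪a, p⟫
  set h₂ : ℝ := ⟪b, p⟫
  set h₃ : ℝ := ⟪b, q⟫
  have h₃0 : h₃ ≠ 0 := by rintro h; rw [h] at hpos; nlinarith [sq_nonneg h₂]
  have key : (c₁ ^ 2 + c₂ * d₁) * h₃ ^ 2
      = (c₁ * h₃ - d₁ * h₂) ^ 2 + d₁ ^ 2 * (h₁ * h₃ - h₂ * h₂) := by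
    linear_combination (d₁ * h₃) * hS
  refine ⟨c₁ ^ 2 + c₂ * d₁, ?_, ?_, ?_⟩
  · refine nonneg_of_mul_nonneg_left ?_ (by positivity : 0 < h₃ ^ 2)
    rw [key]
    positivity
  · apply ext_three <;> simp only [PiLp.add_apply, PiLp.neg_apply, PiLp.smul_apply, smul_eq_mul,
        cross_apply_zero, cross_apply_one, cross_apply_two] <;> ring
  · intro h0
    rw [h0, zero_mul] at key
    have hd₁ : d₁ = 0 := by
      by_contra hd
      have : 0 < d₁ ^ 2 * (h₁ * h₃ - h₂ * h₂) := by positivity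
      nlinarith [sq_nonneg (c₁ * h₃ - d₁ * h₂)]
    subst hd₁
    have hc₁ : c₁ = 0 := by simpa [h₃0] using key.symm
    subst hc₁
    have hc₂ : c₂ = 0 := by simpa [h₃0] using hS
    simp [hc₂]

end CrossProduct

section Punctured

open scoped ContDiff Topology

/-- `F` is smooth on the punctured space `ℝ³ ∖ {0}`. -/
def SmoothOffZero {G : Type*} [NormedAddCommGroup G] [NormedSpace ℝ G] (F : ℝ³ → G) : Prop :=
  ∀ x, x ≠ 0 → ContDiffAt ℝ ∞ F x

section

variable {G : Type*} [NormedAddCommGroup G] [NormedSpace ℝ G] {F : ℝ³ → G} {x : ℝ³}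

lemma SmoothOffZero.differentiableAt (hF : SmoothOffZero F) (hx : x ≠ 0) :
    DifferentiableAt ℝ F x :=
  (hF x hx).differentiableAt (by simp)

lemma SmoothOffZero.hasFDerivAt (hF : SmoothOffZero F) (hx : x ≠ 0) :
    HasFDerivAt F (fderiv ℝ F x) x :=
  (hF.differentiableAt hx).hasFDerivAt

lemma SmoothOffZero.fderiv (hF : SmoothOffZero F) : SmoothOffZero (fderiv ℝ F) :=
  fun x hx => (hF x hx).fderiv_right (by simp)

lemma SmoothOffZero.fderiv_apply (hF : SmoothOffZero F) (w : ℝ³) :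
    SmoothOffZero (fun y => _root_.fderiv ℝ F y w) :=
  fun x hx => (hF.fderiv x hx).clm_apply contDiffAt_const

lemma SmoothOffZero.hasFDerivAt_fderiv_apply (hF : SmoothOffZero F) (hx : x ≠ 0) (w : ℝ³) :
    HasFDerivAt (fun y => _root_.fderiv ℝ F y w)
      ((_root_.fderiv ℝ (_root_.fderiv ℝ F) x).flip w) x := by
  have := (hF.fderiv.hasFDerivAt hx).clm_apply (hasFDerivAt_const w x)
  exact this.congr_fderiv (by ext h; simp)

lemma SmoothOffZero.fderiv_fderiv_comm (hF : SmoothOffZero F) (hx : x ≠ 0) (u v : ℝ³) :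
    _root_.fderiv ℝ (_root_.fderiv ℝ F) x u v = _root_.fderiv ℝ (_root_.fderiv ℝ F) x v u :=
  (hF x hx).isSymmSndFDerivAt
    (by rw [minSmoothness_of_isRCLikeNormedField]
        exact WithTop.coe_le_coe.2 (le_top : (2 : ℕ∞) ≤ ⊤)) u v

lemma HasFDerivAt.eq_of_eqOn_compl_zero {F₁ F₂ : ℝ³ → G} {F₁' F₂' : ℝ³ →L[ℝ] G}
    (h₁ : HasFDerivAt F₁ F₁' x) (h₂ : HasFDerivAt F₂ F₂' x) (hx : x ≠ 0)
    (h : ∀ y, y ≠ 0 → F₁ y = F₂ y) : F₁' = F₂' := by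
  refine h₁.unique (h₂.congr_of_eventuallyEq ?_)
  filter_upwards [isOpen_ne.mem_nhds hx] with y hy using h y hy

end

lemma HasFDerivAt.cross {F₁ F₂ : ℝ³ → ℝ³} {F₁' F₂' : ℝ³ →L[ℝ] ℝ³} {x : ℝ³}
    (h₁ : HasFDerivAt F₁ F₁' x) (h₂ : HasFDerivAt F₂ F₂' x) :
    HasFDerivAt (fun y => cross (F₁ y) (F₂ y))
      ((crossCLM (F₁ x)).comp F₂' + (crossCLM.flip (F₂ x)).comp F₁') x := by
  have := crossCLM.hasFDerivAt_of_bilinear h₁ h₂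
  simp only [crossCLM_apply] at this
  exact this.congr_fderiv (by
    ext1 h
    simp [ContinuousLinearMap.precompR_apply, ContinuousLinearMap.precompL_apply])

lemma SmoothOffZero.cross {F₁ F₂ : ℝ³ → ℝ³} (h₁ : SmoothOffZero F₁) (h₂ : SmoothOffZero F₂) :
    SmoothOffZero (fun y => cross (F₁ y) (F₂ y)) := by
  intro x hx
  simp only [← crossCLM_apply]
  exact (crossCLM.contDiff.contDiffAt.comp x (h₁ x hx)).clm_apply (h₂ x hx)

/-- The extension to `ℝ³ ∖ {0}`, constant along rays, of an immersed sphere `Φ` with unit normal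
field `N` and positive Gauss curvature. -/
structure IsConvexPair (Φ N : ℝ³ → ℝ³) : Prop where
  smooth : SmoothOffZero Φ
  smooth_normal : SmoothOffZero N
  fderiv_self : ∀ x, x ≠ 0 → fderiv ℝ Φ x x = 0
  norm_normal : ∀ x, x ≠ 0 → ‖N x‖ = 1
  inner_normal : ∀ x, x ≠ 0 → ∀ v, ⟪N x, fderiv ℝ Φ x v⟫ = 0
  pos : ∀ u v, cross u v ≠ 0 →
    0 < ⟪cross (fderiv ℝ N (cross u v) u) (fderiv ℝ N (cross u v) v),
      cross (fderiv ℝ Φ (cross u v) u) (fderiv ℝ Φ (cross u v) v)⟫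

/-- `Y` is a rotation field for the deformation `Ξ` of `Φ`. -/
structure IsRotation (Φ Ξ Y : ℝ³ → ℝ³) : Prop where
  smooth : SmoothOffZero Ξ
  smooth_rotation : SmoothOffZero Y
  fderiv_eq : ∀ x, x ≠ 0 → ∀ v, fderiv ℝ Ξ x v = cross (Y x) (fderiv ℝ Φ x v)

variable {Φ N Ξ Y : ℝ³ → ℝ³} {x : ℝ³}

lemma IsConvexPair.cross_ne_zero (h : IsConvexPair Φ N) {u v : ℝ³} (huv : cross u v = x)
    (hx : x ≠ 0) : cross (fderiv ℝ Φ x u) (fderiv ℝ Φ x v) ≠ 0 := by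
  subst huv
  intro h0
  have := h.pos u v hx
  simp [h0] at this

lemma inner_fderiv_comm_of_inner_eq_zero {F : ℝ³ → ℝ³} (hF : SmoothOffZero F)
    (hN : SmoothOffZero N) (hFN : ∀ x, x ≠ 0 → ∀ v, ⟪N x, fderiv ℝ F x v⟫ = 0) (hx : x ≠ 0)
    (u v : ℝ³) :
    ⟪fderiv ℝ F x u, fderiv ℝ N x v⟫ = ⟪fderiv ℝ F x v, fderiv ℝ N x u⟫ := by
  have key : ∀ u v : ℝ³, ⟪N x, fderiv ℝ (fderiv ℝ F) x v u⟫
      + ⟪fderiv ℝ N x v, fderiv ℝ F x u⟫ = 0 := by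
    intro u v
    have h1 := (hN.hasFDerivAt hx).inner ℝ (hF.hasFDerivAt_fderiv_apply hx u)
    have h2 := h1.eq_of_eqOn_compl_zero (hasFDerivAt_const 0 x) hx (fun y hy => hFN y hy u)
    have h3 := congrArg (fun L => L v) h2
    simpa [fderivInnerCLM_apply] using h3
  have h1 := key u v
  have h2 := key v u
  rw [hF.fderiv_fderiv_comm hx] at h1
  rw [real_inner_comm (fderiv ℝ N x v), real_inner_comm (fderiv ℝ N x u)]
  linarith

lemma IsRotation.cross_comm (h : IsRotation Φ Ξ Y) (hΦ : SmoothOffZero Φ) (hx : x ≠ 0)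
    (u v : ℝ³) :
    cross (fderiv ℝ Y x u) (fderiv ℝ Φ x v) = cross (fderiv ℝ Y x v) (fderiv ℝ Φ x u) := by
  have key : ∀ u v : ℝ³, fderiv ℝ (fderiv ℝ Ξ) x u v = cross (Y x) (fderiv ℝ (fderiv ℝ Φ) x u v)
      + cross (fderiv ℝ Y x u) (fderiv ℝ Φ x v) := by
    intro u v
    have h1 := (h.smooth_rotation.hasFDerivAt hx).cross (hΦ.hasFDerivAt_fderiv_apply hx v)
    have h2 := (h.smooth.hasFDerivAt_fderiv_apply hx v).eq_of_eqOn_compl_zero h1 hx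
      (fun y hy => h.fderiv_eq y hy v)
    have h3 := congrArg (fun L => L u) h2
    simpa [crossCLM_apply] using h3
  have h1 := key u v
  have h2 := key v u
  rw [h.smooth.fderiv_fderiv_comm hx, h2, hΦ.fderiv_fderiv_comm hx] at h1
  exact (add_left_cancel h1).symm

lemma IsRotation.fderiv_self (h : IsRotation Φ Ξ Y) (hΦ : IsConvexPair Φ N) (hx : x ≠ 0) :
    fderiv ℝ Y x x = 0 := by
  obtain ⟨u, v, huv⟩ := exists_cross_eq x
  refine eq_zero_of_cross_frame (hΦ.cross_ne_zero huv hx) ?_ ?_ <;>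
  · rw [h.cross_comm hΦ.smooth hx, hΦ.fderiv_self x hx, cross_zero_right]

lemma IsRotation.inner_cross_eq_zero (h : IsRotation Φ Ξ Y) (hΦ : SmoothOffZero Φ) (hx : x ≠ 0)
    (u v : ℝ³) : ⟪fderiv ℝ Y x u, cross (fderiv ℝ Φ x u) (fderiv ℝ Φ x v)⟫ = 0 := by
  rw [inner_cross_rotate, cross_swap, ← h.cross_comm hΦ hx, inner_neg_right,
    inner_self_cross_right, neg_zero]

lemma IsRotation.inner_normal (h : IsRotation Φ Ξ Y) (hΦ : IsConvexPair Φ N) (hx : x ≠ 0)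
    (w : ℝ³) : ⟪N x, fderiv ℝ Y x w⟫ = 0 := by
  obtain ⟨u, v, huv⟩ := exists_cross_eq x
  have hn := hΦ.cross_ne_zero huv hx
  have hN : ⟪cross (fderiv ℝ Φ x u) (fderiv ℝ Φ x v), cross (fderiv ℝ Φ x u) (fderiv ℝ Φ x v)⟫
      • N x = ⟪N x, cross (fderiv ℝ Φ x u) (fderiv ℝ Φ x v)⟫
        • cross (fderiv ℝ Φ x u) (fderiv ℝ Φ x v) := by
    rw [inner_cross_smul_eq_dual, hΦ.inner_normal x hx, hΦ.inner_normal x hx]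
    simp
  have hu := h.inner_cross_eq_zero hΦ.smooth hx u v
  have hv : ⟪fderiv ℝ Y x v, cross (fderiv ℝ Φ x u) (fderiv ℝ Φ x v)⟫ = 0 := by
    rw [inner_cross_rotate, inner_cross_rotate, h.cross_comm hΦ.smooth hx, inner_self_cross_right]
  have hw : ⟪cross (fderiv ℝ Φ x u) (fderiv ℝ Φ x v), fderiv ℝ Y x w⟫ = 0 := by
    obtain ⟨c, d, e, rfl⟩ := exists_eq_combination (u := u) (v := v) (by rwa [huv]) w
    rw [huv, map_add, map_add, map_smul, map_smul, map_smul, h.fderiv_self hΦ hx, real_inner_comm]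
    simp [inner_add_left, inner_smul_left, hu, hv]
  have := congrArg (fun z => ⟪z, fderiv ℝ Y x w⟫) hN
  simp only [inner_smul_left, hw, conj_trivial, mul_zero] at this
  exact (mul_eq_zero.1 this).resolve_left (by simpa using hn)

lemma IsRotation.exists_cross_eq_neg_smul (h : IsRotation Φ Ξ Y) (hΦ : IsConvexPair Φ N)
    (hx : x ≠ 0) {u v : ℝ³} (huv : cross u v = x) :
    ∃ t : ℝ, 0 ≤ t ∧ cross (fderiv ℝ Y x u) (fderiv ℝ Y x v)
      = -(t • cross (fderiv ℝ Φ x u) (fderiv ℝ Φ x v)) ∧ (t = 0 → fderiv ℝ Y x = 0) := by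
  have hpos := hΦ.pos u v (by rwa [huv])
  rw [huv] at hpos
  obtain ⟨t, ht, hcr, h0⟩ := _root_.exists_cross_eq_neg_smul hpos
    (h.inner_cross_eq_zero hΦ.smooth hx u v)
    (by rw [inner_cross_rotate, inner_cross_rotate, h.cross_comm hΦ.smooth hx, inner_self_cross_right])
    (h.cross_comm hΦ.smooth hx u v)
    (inner_fderiv_comm_of_inner_eq_zero hΦ.smooth hΦ.smooth_normal hΦ.inner_normal hx u v)
    (inner_fderiv_comm_of_inner_eq_zero h.smooth_rotation hΦ.smooth_normal
      (fun y hy => h.inner_normal hΦ hy) hx u v)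
  refine ⟨t, ht, hcr, fun ht0 => ?_⟩
  ext1 w
  obtain ⟨c, d, e, rfl⟩ := exists_eq_combination (u := u) (v := v) (by rwa [huv]) w
  rw [huv, map_add, map_add, map_smul, map_smul, map_smul, h.fderiv_self hΦ hx, (h0 ht0).1,
    (h0 ht0).2]
  simp

/-- The rotation field exists. -/
lemma IsConvexPair.exists_isRotation (hΦ : IsConvexPair Φ N) (hΞ : SmoothOffZero Ξ)
    (hΞ0 : ∀ x, x ≠ 0 → fderiv ℝ Ξ x x = 0)
    (hiso : ∀ x, x ≠ 0 → ∀ u v,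
      ⟪fderiv ℝ Ξ x u, fderiv ℝ Φ x v⟫ + ⟪fderiv ℝ Φ x u, fderiv ℝ Ξ x v⟫ = 0) :
    ∃ Y, IsRotation Φ Ξ Y := by
  have hself : ∀ x, x ≠ 0 → ∀ u, ⟪fderiv ℝ Ξ x u, fderiv ℝ Φ x u⟫ = 0 := by
    intro x hx u
    have := hiso x hx u u
    rw [real_inner_comm (fderiv ℝ Ξ x u)] at this
    linarith
  have hrot : ∀ x u v : ℝ³, x ≠ 0 → cross (fderiv ℝ Φ x u) (fderiv ℝ Φ x v) ≠ 0 →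
      cross (rotationVector (fderiv ℝ Φ x u) (fderiv ℝ Φ x v) (fderiv ℝ Ξ x u) (fderiv ℝ Ξ x v))
          (fderiv ℝ Φ x u) = fderiv ℝ Ξ x u ∧
      cross (rotationVector (fderiv ℝ Φ x u) (fderiv ℝ Φ x v) (fderiv ℝ Ξ x u) (fderiv ℝ Ξ x v))
          (fderiv ℝ Φ x v) = fderiv ℝ Ξ x v := by
    intro x u v hx hn
    refine cross_rotationVector hn (hself x hx u) (hself x hx v) ?_
    rw [real_inner_comm (fderiv ℝ Φ x u)]
    exact hiso x hx u v
  have hex : ∀ x : ℝ³, ∃ y, x ≠ 0 → ∀ w, fderiv ℝ Ξ x w = cross y (fderiv ℝ Φ x w) := by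
    intro x
    obtain ⟨u, v, huv⟩ := exists_cross_eq x
    refine ⟨rotationVector (fderiv ℝ Φ x u) (fderiv ℝ Φ x v) (fderiv ℝ Ξ x u) (fderiv ℝ Ξ x v),
      fun hx w => ?_⟩
    obtain ⟨h1, h2⟩ := hrot x u v hx (hΦ.cross_ne_zero huv hx)
    obtain ⟨c, d, e, rfl⟩ := exists_eq_combination (u := u) (v := v) (by rwa [huv]) w
    simp only [huv, map_add, map_smul, hΞ0 x hx, hΦ.fderiv_self x hx, cross_add_right,
      cross_smul_right, cross_zero_right, h1, h2]
  choose Y hY using hex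
  refine ⟨Y, hΞ, fun x hx => ?_, hY⟩
  obtain ⟨u, v, huv⟩ := exists_cross_eq x
  have hn := hΦ.cross_ne_zero huv hx
  have hu := hΦ.smooth.fderiv_apply u
  have hv := hΦ.smooth.fderiv_apply v
  have hc := hu.cross hv
  have hα := hΞ.fderiv_apply u
  have hβ := hΞ.fderiv_apply v
  have hsm : ContDiffAt ℝ ∞ (fun y => rotationVector (fderiv ℝ Φ y u) (fderiv ℝ Φ y v)
      (fderiv ℝ Ξ y u) (fderiv ℝ Ξ y v)) x := by
    unfold rotationVector
    refine ContDiffAt.smul (((hc x hx).inner ℝ (hc x hx)).inv (by simpa using hn)) ?_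
    exact ((((hβ x hx).inner ℝ (hc x hx)).smul (hu x hx)).sub
      (((hα x hx).inner ℝ (hc x hx)).smul (hv x hx))).add
      (((hα x hx).inner ℝ (hv x hx)).smul (hc x hx))
  refine hsm.congr_of_eventuallyEq ?_
  filter_upwards [isOpen_ne.mem_nhds hx, (hc x hx).continuousAt.eventually_ne hn] with y hy hyn
  obtain ⟨h1, h2⟩ := hrot y u v hy hyn
  refine sub_eq_zero.1 (eq_zero_of_cross_frame hyn ?_ ?_)
  all_goals rw [sub_eq_add_neg, ← neg_one_smul ℝ (rotationVector _ _ _ _), cross_add_left,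
    cross_smul_left]
  · rw [h1, hY y hy u]; simp
  · rw [h2, hY y hy v]; simp

end Punctured

section IntegralFormula

open scoped ContDiff Topology
open MeasureTheory

local notation "𝐞" => fun i : Fin 3 => EuclideanSpace.single i (1 : ℝ)

/-- A smooth radial function with compact support in `ℝ³ ∖ {0}`. -/
structure IsRadialCutoff (g : ℝ³ → ℝ) : Prop where
  contDiff : ContDiff ℝ ∞ g
  nonneg : ∀ x, 0 ≤ g x
  hasCompactSupport : HasCompactSupport g
  eventually_eq_zero : ∀ᶠ x in 𝓝 0, g x = 0
  exists_fderiv_eq : ∀ x, ∃ c : ℝ, ∀ v, fderiv ℝ g x v = c * ⟪x, v⟫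

lemma exists_isRadialCutoff {x₀ : ℝ³} (hx₀ : x₀ ≠ 0) : ∃ g, IsRadialCutoff g ∧ g x₀ = 1 := by
  have hc : 0 < ‖x₀‖ ^ 2 := by positivity
  let ψ : ContDiffBump (‖x₀‖ ^ 2) :=
    ⟨‖x₀‖ ^ 2 / 4, ‖x₀‖ ^ 2 / 2, by positivity, by linarith⟩
  have hψ0 : ∀ s, ‖x₀‖ ^ 2 / 2 ≤ dist s (‖x₀‖ ^ 2) → ψ s = 0 := fun s hs =>
    ψ.zero_of_le_dist hs
  refine ⟨fun x => ψ (‖x‖ ^ 2), ⟨?_, fun x => ψ.nonneg, ?_, ?_, ?_⟩, ?_⟩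
  · exact ψ.contDiff.comp (contDiff_norm_sq ℝ)
  · refine HasCompactSupport.intro (isCompact_closedBall (0 : ℝ³) (2 * ‖x₀‖)) fun x hx => hψ0 _ ?_
    rw [mem_closedBall_zero_iff, not_le] at hx
    rw [Real.dist_eq]
    refine le_trans ?_ (le_abs_self _)
    nlinarith [norm_nonneg x₀]
  · have : ∀ᶠ x : ℝ³ in 𝓝 0, ‖x‖ ^ 2 < ‖x₀‖ ^ 2 / 2 :=
      (continuous_norm.pow 2).continuousAt.eventually_lt continuousAt_const (by simpa using half_pos hc)
    filter_upwards [this] with x hx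
    refine hψ0 _ ?_
    rw [dist_comm, Real.dist_eq]
    refine le_trans ?_ (le_abs_self _)
    linarith
  · intro x
    refine ⟨deriv ψ (‖x‖ ^ 2) * 2, fun v => ?_⟩
    have h1 : HasDerivAt ψ (deriv ψ (‖x‖ ^ 2)) (‖x‖ ^ 2) :=
      ((ψ.contDiff (n := 1)).differentiable (by simp) _).hasDerivAt
    have h2 := h1.comp_hasFDerivAt x (hasStrictFDerivAt_norm_sq x).hasFDerivAt
    have h3 := h2.fderiv
    simp only [Function.comp_def] at h3
    rw [h3]
    simp [mul_assoc]
  · exact ψ.one_of_mem_closedBall (by simp; positivity)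

variable {g : ℝ³ → ℝ}

lemma IsRadialCutoff.contDiff_mul (hg : IsRadialCutoff g) {F : ℝ³ → ℝ} (hF : SmoothOffZero F) :
    ContDiff ℝ ∞ (fun x => g x * F x) := by
  rw [contDiff_iff_contDiffAt]
  intro x
  rcases eq_or_ne x 0 with rfl | hx
  · refine (contDiffAt_const (c := (0 : ℝ))).congr_of_eventuallyEq ?_
    filter_upwards [hg.eventually_eq_zero] with y hy
    simp [hy]
  · exact hg.contDiff.contDiffAt.mul (hF x hx)

lemma integral_fderiv_apply_eq_zero {f : ℝ³ → ℝ} (hf : ContDiff ℝ ∞ f) (hs : HasCompactSupport f)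
    (v : ℝ³) : ∫ x, fderiv ℝ f x v = 0 := by
  have hd : Differentiable ℝ f := hf.differentiable (by simp)
  have hc : Continuous fun x => fderiv ℝ f x v :=
    (hf.continuous_fderiv (by simp)).clm_apply continuous_const
  have hi : Integrable (fun x => fderiv ℝ f x v) :=
    hc.integrable_of_hasCompactSupport (hs.fderiv_apply ℝ v)
  have := integral_mul_fderiv_eq_neg_fderiv_mul_of_integrable (𝕜 := ℝ) (μ := volume)
    (f := fun _ : ℝ³ => (1 : ℝ)) (g := f) (v := v) (by simp) (by simpa using hi)
    (by simpa using hf.continuous.integrable_of_hasCompactSupport hs)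
    (by fun_prop) (fun x _ => hd x)
  simpa using this

/-- The integral of a curl tangential to the spheres around the origin vanishes. -/
lemma IsRadialCutoff.integral_curl_eq_zero (hg : IsRadialCutoff g) {W : Fin 3 → ℝ³ → ℝ}
    (hW : ∀ i, SmoothOffZero (W i)) :
    ∫ x, g x * (x 0 * (fderiv ℝ (W 2) x (𝐞 1) - fderiv ℝ (W 1) x (𝐞 2))
      + x 1 * (fderiv ℝ (W 0) x (𝐞 2) - fderiv ℝ (W 2) x (𝐞 0))
      + x 2 * (fderiv ℝ (W 1) x (𝐞 0) - fderiv ℝ (W 0) x (𝐞 1))) = 0 := by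
  have hx : ∀ i : Fin 3, ContDiff ℝ ∞ (fun x : ℝ³ => x i) := fun i =>
    (EuclideanSpace.proj (𝕜 := ℝ) i).contDiff
  have hV : ∀ i j : Fin 3, SmoothOffZero (fun x => x i * W j x - x j * W i x) := fun i j x h =>
    ((hx i).contDiffAt.mul (hW j x h)).sub ((hx j).contDiffAt.mul (hW i x h))
  let A : Fin 3 → Fin 3 → Fin 3 → ℝ³ → ℝ := fun i j k x =>
    fderiv ℝ (fun x => g x * (x i * W j x - x j * W i x)) x (𝐞 k)
  have hI : ∀ i j k : Fin 3, Integrable (A i j k) := by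
    intro i j k
    refine Continuous.integrable_of_hasCompactSupport ?_ ?_
    · exact ((hg.contDiff_mul (hV i j)).continuous_fderiv (by simp)).clm_apply continuous_const
    · exact (hg.hasCompactSupport.mul_right).fderiv_apply ℝ _
  have h0 : ∀ i j k : Fin 3, ∫ x, A i j k x = 0 := fun i j k =>
    integral_fderiv_apply_eq_zero (hg.contDiff_mul (hV i j)) hg.hasCompactSupport.mul_right _
  have key : ∫ x, (A 1 2 0 x + A 2 0 1 x + A 0 1 2 x) = 0 := by
    have h1 := integral_add ((hI 1 2 0).add (hI 2 0 1)) (hI 0 1 2)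
    simp only [Pi.add_apply] at h1
    rw [h1, integral_add (hI 1 2 0) (hI 2 0 1), h0, h0, h0]
    simp
  rw [← neg_eq_zero, ← integral_neg, ← key]
  congr 1
  ext x
  have hD : ∀ i j k : Fin 3, A i j k x
        = fderiv ℝ g x (𝐞 k) * (x i * W j x - x j * W i x) + g x * (𝐞 k i * W j x - 𝐞 k j * W i x
          + (x i * fderiv ℝ (W j) x (𝐞 k) - x j * fderiv ℝ (W i) x (𝐞 k))) := by
    intro i j k
    rcases eq_or_ne x 0 with rfl | h
    · have : (fun x => g x * (x i * W j x - x j * W i x)) =ᶠ[𝓝 0] fun _ => 0 := by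
        filter_upwards [hg.eventually_eq_zero] with y hy
        simp [hy]
      simp only [A]
      rw [this.fderiv_eq, hg.eventually_eq_zero.self_of_nhds]
      simp
    · have hp : ∀ i : Fin 3, HasFDerivAt (fun x : ℝ³ => x i) (EuclideanSpace.proj (𝕜 := ℝ) i) x :=
        fun i => (EuclideanSpace.proj (𝕜 := ℝ) i).hasFDerivAt
      have h1 := ((hp i).mul ((hW j).hasFDerivAt h)).sub ((hp j).mul ((hW i).hasFDerivAt h))
      have h2 := ((hg.contDiff.differentiable (by simp) x).hasFDerivAt).mul h1
      have h3 := h2.fderiv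
      simp only [Pi.mul_def, Pi.sub_def] at h3
      simp only [A]
      rw [h3]
      simp
      ring
  obtain ⟨c, hc⟩ := hg.exists_fderiv_eq x
  rw [hD, hD, hD]
  simp only [hc]
  simp [EuclideanSpace.inner_single_right]
  ring

/-- The cofactor map of `L`, characterised by `u × v ↦ L u × L v`. -/
def cofactor (L : ℝ³ →L[ℝ] ℝ³) (z : ℝ³) : ℝ³ :=
  z 0 • cross (L (𝐞 1)) (L (𝐞 2)) + z 1 • cross (L (𝐞 2)) (L (𝐞 0))
    + z 2 • cross (L (𝐞 0)) (L (𝐞 1))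

lemma cofactor_cross (L : ℝ³ →L[ℝ] ℝ³) (u v : ℝ³) :
    cofactor L (cross u v) = cross (L u) (L v) := by
  have he : ∀ w : ℝ³, w = w 0 • 𝐞 0 + w 1 • 𝐞 1 + w 2 • 𝐞 2 := by
    intro w
    apply ext_three <;> simp
  have hL : ∀ w : ℝ³, L w = w 0 • L (𝐞 0) + w 1 • L (𝐞 1) + w 2 • L (𝐞 2) := by
    intro w
    conv_lhs => rw [he w]
    simp only [map_add, map_smul]
  rw [hL u, hL v, cofactor]
  apply ext_three <;> simp only [PiLp.add_apply, PiLp.smul_apply, smul_eq_mul,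
    cross_apply_zero, cross_apply_one, cross_apply_two] <;> ring

lemma SmoothOffZero.inner_cofactor {F G : ℝ³ → ℝ³} (hF : SmoothOffZero F) (hG : SmoothOffZero G) :
    SmoothOffZero (fun x => ⟪G x, cofactor (_root_.fderiv ℝ F x) x⟫) := by
  intro x hx
  have hp : ∀ i : Fin 3, ContDiffAt ℝ ∞ (fun x : ℝ³ => x i) x := fun i =>
    (EuclideanSpace.proj (𝕜 := ℝ) i).contDiff.contDiffAt
  have hc : ∀ i j k : Fin 3, ContDiffAt ℝ ∞ (fun x : ℝ³ => x k •
      _root_.cross (_root_.fderiv ℝ F x (𝐞 i)) (_root_.fderiv ℝ F x (𝐞 j))) x := fun i j k =>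
    (hp k).smul (((hF.fderiv_apply _).cross (hF.fderiv_apply _)) x hx)
  exact (hG x hx).inner ℝ (((hc _ _ _).add (hc _ _ _)).add (hc _ _ _))

variable {Φ N Ξ Y : ℝ³ → ℝ³}

/-- Blaschke's integral formula. -/
lemma IsRotation.integral_inner_cofactor_eq_zero (h : IsRotation Φ Ξ Y) (hΦ : SmoothOffZero Φ)
    (hg : IsRadialCutoff g) (P : ℝ³) :
    ∫ x, g x * ⟪Φ x - P, cofactor (fderiv ℝ Y x) x⟫ = 0 := by
  have hY := h.smooth_rotation
  have hΦP : SmoothOffZero (fun x => Φ x - P) := fun x hx => (hΦ x hx).sub contDiffAt_const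
  let W : Fin 3 → ℝ³ → ℝ := fun i x => ⟪Φ x - P, cross (Y x) (fderiv ℝ Y x (𝐞 i))⟫
  have hW : ∀ i, SmoothOffZero (W i) := fun i x hx =>
    (hΦP x hx).inner ℝ ((hY.cross (hY.fderiv_apply _)) x hx)
  have hD : ∀ x, x ≠ 0 → ∀ i j, fderiv ℝ (W j) x (𝐞 i) - fderiv ℝ (W i) x (𝐞 j)
      = 2 * ⟪Φ x - P, cross (fderiv ℝ Y x (𝐞 i)) (fderiv ℝ Y x (𝐞 j))⟫ := by
    intro x hx i j
    have hD1 : ∀ i j, fderiv ℝ (W j) x (𝐞 i)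
        = ⟪Φ x - P, cross (Y x) (fderiv ℝ (fderiv ℝ Y) x (𝐞 i) (𝐞 j))⟫
          + ⟪Φ x - P, cross (fderiv ℝ Y x (𝐞 i)) (fderiv ℝ Y x (𝐞 j))⟫
          + ⟪fderiv ℝ Φ x (𝐞 i), cross (Y x) (fderiv ℝ Y x (𝐞 j))⟫ := by
      intro i j
      have h1 := ((hΦ.hasFDerivAt hx).sub_const P).inner ℝ
        ((hY.hasFDerivAt hx).cross (hY.hasFDerivAt_fderiv_apply hx (𝐞 j)))
      have h2 := h1.fderiv
      change fderiv ℝ (W j) x = _ at h2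
      rw [h2]
      simp [fderivInnerCLM_apply, crossCLM_apply, inner_add_right]
    have h3 : ⟪fderiv ℝ Φ x (𝐞 i), cross (Y x) (fderiv ℝ Y x (𝐞 j))⟫
        = ⟪fderiv ℝ Φ x (𝐞 j), cross (Y x) (fderiv ℝ Y x (𝐞 i))⟫ := by
      rw [inner_cross_rotate, h.cross_comm hΦ hx, ← inner_cross_rotate]
    rw [hD1, hD1, h3, hY.fderiv_fderiv_comm hx (𝐞 i), cross_swap (fderiv ℝ Y x (𝐞 j)),
      inner_neg_right]
    ring
  have key := hg.integral_curl_eq_zero hW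
  have e : ∀ x, g x * (x 0 * (fderiv ℝ (W 2) x (𝐞 1) - fderiv ℝ (W 1) x (𝐞 2))
      + x 1 * (fderiv ℝ (W 0) x (𝐞 2) - fderiv ℝ (W 2) x (𝐞 0))
      + x 2 * (fderiv ℝ (W 1) x (𝐞 0) - fderiv ℝ (W 0) x (𝐞 1)))
      = 2 * (g x * ⟪Φ x - P, cofactor (fderiv ℝ Y x) x⟫) := by
    intro x
    rcases eq_or_ne x 0 with rfl | hx
    · simp [hg.eventually_eq_zero.self_of_nhds]
    · rw [hD x hx, hD x hx, hD x hx, cofactor, inner_add_right, inner_add_right, inner_smul_right,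
        inner_smul_right, inner_smul_right]
      ring
  simp only [e] at key
  rw [integral_const_mul] at key
  simpa using key

/-- The complement of a closed ray starting at the origin. -/
def rayCompl (p : ℝ³) : Set ℝ³ := {x | ∀ t : ℝ, 0 ≤ t → x ≠ t • p}

lemma ne_zero_of_mem_rayCompl {p x : ℝ³} (hx : x ∈ rayCompl p) : x ≠ 0 := by
  simpa using hx 0 le_rfl

lemma isPreconnected_rayCompl {p : ℝ³} (hp : p ≠ 0) : IsPreconnected (rayCompl p) := by
  have hray : ∀ t : ℝ, 0 ≤ t → (t + 1) • p ≠ 0 := fun t ht h0 =>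
    (smul_eq_zero.1 h0).elim (fun h => by linarith) hp
  have hmem : -p ∈ rayCompl p := fun t ht h => hray t ht (by rw [add_smul, ← h]; module)
  have hs : StarConvex ℝ (-p) (rayCompl p) := by
    intro x hx a b ha hb hab t ht hxt
    rcases hb.eq_or_lt with rfl | hb
    · have ha1 : a = 1 := by linarith
      subst ha1
      exact hray t ht (by rw [add_smul, ← hxt]; module)
    · refine hx ((t + a) / b) (by positivity) ?_
      have : b • x = (t + a) • p := by
        rw [add_smul, ← hxt]; module
      rw [div_eq_inv_mul, mul_smul, ← this, inv_smul_smul₀ hb.ne']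
  exact (hs.isPathConnected hmem).isConnected.isPreconnected

/-- The derivative of the rotation field vanishes off the ray of a point from which the whole
surface is visible. -/
lemma IsRotation.fderiv_eq_zero_of_mem_rayCompl (h : IsRotation Φ Ξ Y) (hΦ : IsConvexPair Φ N)
    {p P : ℝ³} (hp : p ≠ 0) (hP : ∀ x, x ≠ 0 → x ∉ rayCompl p → Φ x = P)
    (hσ : ∀ x ∈ rayCompl p, ⟪Φ x - P, cofactor (fderiv ℝ Φ x) x⟫ ≠ 0)
    {x₀ : ℝ³} (hx₀ : x₀ ∈ rayCompl p) : fderiv ℝ Y x₀ = 0 := by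
  have hΦP : SmoothOffZero (fun x => Φ x - P) := fun x hx => (hΦ.smooth x hx).sub contDiffAt_const
  have hsign : ∀ s : ℝ, (∀ x ∈ rayCompl p, 0 < s * ⟪Φ x - P, cofactor (fderiv ℝ Φ x) x⟫) →
      fderiv ℝ Y x₀ = 0 := by
    intro s hs
    obtain ⟨g, hg, hg1⟩ := exists_isRadialCutoff (ne_zero_of_mem_rayCompl hx₀)
    have ht : ∀ x, x ≠ 0 → ∃ t : ℝ, 0 ≤ t ∧ cofactor (fderiv ℝ Y x) x
        = -(t • cofactor (fderiv ℝ Φ x) x) ∧ (t = 0 → fderiv ℝ Y x = 0) := by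
      intro x hx
      obtain ⟨u, v, huv⟩ := exists_cross_eq x
      obtain ⟨t, ht0, ht1, ht2⟩ := h.exists_cross_eq_neg_smul hΦ hx huv
      refine ⟨t, ht0, ?_, ht2⟩
      nth_rw 2 [← huv]
      nth_rw 3 [← huv]
      rw [cofactor_cross, cofactor_cross, ht1]
    let f : ℝ³ → ℝ := fun x => g x * (-s * ⟪Φ x - P, cofactor (fderiv ℝ Y x) x⟫)
    have hfc : Continuous f := (hg.contDiff_mul fun x hx =>
      contDiffAt_const.mul (h.smooth_rotation.inner_cofactor hΦP x hx)).continuous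
    have hfs : HasCompactSupport f := hg.hasCompactSupport.mul_right
    have hf0 : 0 ≤ f := by
      intro x
      refine mul_nonneg (hg.nonneg x) ?_
      rcases eq_or_ne x 0 with rfl | hx
      · simp [cofactor]
      by_cases hxp : x ∈ rayCompl p
      · obtain ⟨t, ht0, ht1, -⟩ := ht x hx
        rw [ht1, inner_neg_right, inner_smul_right]
        have := mul_nonneg ht0 (hs x hxp).le
        linarith
      · simp [hP x hx hxp]
    have hint : ∫ x, f x = 0 := by
      have := h.integral_inner_cofactor_eq_zero hΦ.smooth hg P
      have e : ∀ x, f x = -s * (g x * ⟪Φ x - P, cofactor (fderiv ℝ Y x) x⟫) := fun x => by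
        simp only [f]; ring
      simp only [e, integral_const_mul, this, mul_zero]
    by_contra hne
    obtain ⟨t, ht0, ht1, ht2⟩ := ht x₀ (ne_zero_of_mem_rayCompl hx₀)
    have htpos : 0 < t := ht0.lt_of_ne fun h0 => hne (ht2 h0.symm)
    have hfx : f x₀ ≠ 0 := by
      simp only [f, hg1, ht1, inner_neg_right, inner_smul_right]
      have := mul_pos htpos (hs x₀ hx₀)
      intro h0
      linarith
    exact (hfc.integral_pos_of_hasCompactSupport_nonneg_nonzero hfs hf0 hfx).ne' hint
  have hcont : ContinuousOn (fun x => ⟪Φ x - P, cofactor (fderiv ℝ Φ x) x⟫) (rayCompl p) :=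
    fun x hx => ((hΦ.smooth.inner_cofactor hΦP) x
      (ne_zero_of_mem_rayCompl hx)).continuousAt.continuousWithinAt
  rcases (hσ x₀ hx₀).lt_or_gt with h0 | h0
  · refine hsign (-1) fun x hx => ?_
    by_contra hle
    obtain ⟨y, hy, hy0⟩ := (isPreconnected_rayCompl hp).intermediate_value hx₀ hx hcont
      (show (0 : ℝ) ∈ Set.Icc _ _ from ⟨h0.le, by linarith⟩)
    exact hσ y hy hy0
  · refine hsign 1 fun x hx => ?_
    by_contra hle
    obtain ⟨y, hy, hy0⟩ := (isPreconnected_rayCompl hp).intermediate_value hx hx₀ hcont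
      (show (0 : ℝ) ∈ Set.Icc _ _ from ⟨by linarith, h0.le⟩)
    exact hσ y hy hy0

/-- A deformation with constant rotation field is trivial. -/
lemma IsRotation.exists_eq_cross_add (h : IsRotation Φ Ξ Y) (hΦ : SmoothOffZero Φ)
    (hY : ∀ x, x ≠ 0 → fderiv ℝ Y x = 0) :
    ∃ a b : ℝ³, ∀ x, x ≠ 0 → Ξ x = cross a (Φ x) + b := by
  have hconst : ∀ F : ℝ³ → ℝ³, SmoothOffZero F → (∀ x, x ≠ 0 → fderiv ℝ F x = 0) →
      ∃ a, ∀ x, x ≠ 0 → F x = a := by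
    intro F hF hF0
    have hpre : IsPreconnected ({0}ᶜ : Set ℝ³) :=
      (isConnected_compl_singleton_of_one_lt_rank (by
        rw [← Module.finrank_eq_rank]; simp) 0).isPreconnected
    obtain ⟨a, ha⟩ := isOpen_compl_singleton.exists_is_const_of_fderiv_eq_zero hpre
      (fun x hx => (hF.differentiableAt hx).differentiableWithinAt) (fun x hx => hF0 x hx)
    exact ⟨a, fun x hx => ha x hx⟩
  obtain ⟨a, ha⟩ := hconst Y h.smooth_rotation hY
  have hs : SmoothOffZero (fun x => Ξ x - cross a (Φ x)) := fun x hx =>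
    (h.smooth x hx).sub ((SmoothOffZero.cross (fun _ _ => contDiffAt_const) hΦ) x hx)
  obtain ⟨b, hb⟩ := hconst _ hs fun x hx => by
    have h1 := (h.smooth.hasFDerivAt hx).sub
      ((hasFDerivAt_const a x).cross (hΦ.hasFDerivAt hx))
    have h2 := h1.fderiv
    simp only [Pi.sub_def] at h2
    rw [h2]
    ext1 v
    simp [crossCLM_apply, h.fderiv_eq x hx, ha x hx]
  exact ⟨a, b, fun x hx => by rw [← hb x hx]; abel⟩

end IntegralFormula

section Visibility

open scoped ContDiff Topology

/-- `F` is constant along open rays from the origin. -/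
def IsRadial (F : ℝ³ → ℝ³) : Prop := ∀ x, x ≠ 0 → F (‖x‖⁻¹ • x) = F x

lemma IsRadial.fderiv_self {F : ℝ³ → ℝ³} (hF : IsRadial F) (hs : SmoothOffZero F) {x : ℝ³}
    (hx : x ≠ 0) : fderiv ℝ F x x = 0 := by
  have h1 : HasDerivAt (fun s : ℝ => s • x) x 1 := by
    simpa using (hasDerivAt_id (1 : ℝ)).smul_const x
  have h2 : HasDerivAt (fun s : ℝ => F (s • x)) (fderiv ℝ F x x) 1 :=
    HasFDerivAt.comp_hasDerivAt_of_eq 1 (hs.hasFDerivAt hx) h1 (by simp)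
  have h3 : (fun s : ℝ => F (s • x)) =ᶠ[𝓝 1] fun _ => F x := by
    filter_upwards [lt_mem_nhds (show (0 : ℝ) < 1 by norm_num)] with s hs
    rw [← hF (s • x) (smul_ne_zero hs.ne' hx), ← hF x hx, norm_smul, Real.norm_of_nonneg hs.le,
      smul_smul, mul_inv, mul_right_comm, inv_mul_cancel₀ hs.ne', one_mul]
  exact h2.unique ((hasDerivAt_const (1 : ℝ) (F x)).congr_of_eventuallyEq h3)

variable {Φ N : ℝ³ → ℝ³}

lemma IsConvexPair.inner_normal_fderiv (h : IsConvexPair Φ N) {x : ℝ³} (hx : x ≠ 0) (v : ℝ³) :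
    ⟪N x, fderiv ℝ N x v⟫ = 0 := by
  have h1 := (h.smooth_normal.hasFDerivAt hx).inner ℝ (h.smooth_normal.hasFDerivAt hx)
  have h2 := h1.eq_of_eqOn_compl_zero (hasFDerivAt_const 1 x) hx
    (fun y hy => by rw [real_inner_self_eq_norm_sq, h.norm_normal y hy, one_pow])
  have h3 := congrArg (fun L => L v) h2
  simp only [ContinuousLinearMap.comp_apply, fderivInnerCLM_apply, ContinuousLinearMap.prod_apply,
    zero_apply] at h3
  rw [real_inner_comm (N x)] at h3
  linarith

lemma IsConvexPair.eq_zero_of_fderiv_normal_eq_zero (h : IsConvexPair Φ N) {x v : ℝ³} (hx : x ≠ 0)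
    (hxv : ⟪x, v⟫ = 0) (hv : fderiv ℝ N x v = 0) : v = 0 := by
  by_contra hv0
  have hvv : ⟪v, v⟫ ≠ (0 : ℝ) := by simpa using hv0
  have huv : cross ((⟪v, v⟫ : ℝ)⁻¹ • cross v x) v = x := by
    have : cross (cross v x) v = ⟪v, v⟫ • x - ⟪x, v⟫ • v := by
      apply ext_three <;> simp only [PiLp.sub_apply, PiLp.smul_apply, smul_eq_mul,
        inner_eq_sum_three, cross_apply_zero, cross_apply_one, cross_apply_two] <;> ring
    rw [cross_smul_left, this, hxv, zero_smul, sub_zero, inv_smul_smul₀ hvv]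
  have := h.pos _ _ (by rwa [huv])
  rw [huv, hv, cross_zero_right, inner_zero_left] at this
  exact lt_irrefl _ this

/-- The Gauss map, extended to be homogeneous of degree one, is a local diffeomorphism. -/
lemma IsConvexPair.exists_hasStrictFDerivAt (h : IsConvexPair Φ N) {x : ℝ³} (hx : x ≠ 0) :
    ∃ L : ℝ³ ≃L[ℝ] ℝ³, HasStrictFDerivAt (fun y => ‖y‖ • N y) (L : ℝ³ →L[ℝ] ℝ³) x := by
  have hs : ContDiffAt ℝ ∞ (fun y => ‖y‖ • N y) x :=
    (contDiffAt_norm ℝ hx).smul (h.smooth_normal x hx)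
  have hstrict := hs.hasStrictFDerivAt (by simp)
  have hnorm : HasFDerivAt (fun y : ℝ³ => ‖y‖) (‖x‖⁻¹ • innerSL ℝ x) x := by
    have h1 := (hasStrictFDerivAt_norm_sq x).hasFDerivAt.sqrt (by positivity)
    simp only [Real.sqrt_sq (norm_nonneg _)] at h1
    refine h1.congr_fderiv ?_
    ext v
    simp
    field_simp
  have hD := (hnorm.smul (h.smooth_normal.hasFDerivAt hx)).fderiv
  have hinj : Function.Injective (fderiv ℝ (fun y => ‖y‖ • N y) x) := by
    rw [injective_iff_map_eq_zero]
    intro v hv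
    change fderiv ℝ (fun y => ‖y‖ • N y) x = _ at hD
    rw [hD] at hv
    simp only [add_apply, smul_apply, ContinuousLinearMap.smulRight_apply, innerSL_apply_apply,
      smul_eq_mul] at hv
    have h1 := congrArg (fun z => ⟪N x, z⟫) hv
    simp only [inner_add_right, inner_smul_right, h.inner_normal_fderiv hx, inner_zero_right,
      real_inner_self_eq_norm_sq, h.norm_normal x hx] at h1
    have hxv : ⟪x, v⟫ = 0 := by simpa [hx] using h1
    refine h.eq_zero_of_fderiv_normal_eq_zero hx hxv ?_
    simpa [hxv, hx] using hv
  let L : ℝ³ ≃ₗ[ℝ] ℝ³ :=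
    LinearEquiv.ofInjectiveEndo (fderiv ℝ (fun y => ‖y‖ • N y) x : ℝ³ →ₗ[ℝ] ℝ³) hinj
  refine ⟨L.toContinuousLinearEquiv, ?_⟩
  have e : (L.toContinuousLinearEquiv : ℝ³ →L[ℝ] ℝ³) = fderiv ℝ (fun y => ‖y‖ • N y) x := by
    ext v
    rfl
  rw [e]
  exact hstrict

/-- The Gauss map of a convex surface is injective. -/
lemma IsConvexPair.injective_normal (h : IsConvexPair Φ N) {x y : ℝ³} (hx : ‖x‖ = 1)
    (hy : ‖y‖ = 1) (hxy : N x = N y) : x = y := by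
  have hne : ∀ x : 𝕊², (x : ℝ³) ≠ 0 := fun x => ne_zero_of_mem_unit_sphere x
  let f : 𝕊² → 𝕊² := fun x => ⟨N x, by simpa using h.norm_normal x (hne x)⟩
  have hf : Continuous f := by
    refine Continuous.subtype_mk ?_ _
    rw [continuous_iff_continuousAt]
    exact fun x => (h.smooth_normal x (hne x)).continuousAt.comp continuousAt_subtype_val
  have hopen : IsOpenMap f := by
    refine IsOpenMap.of_nhds_le fun x A hA => ?_
    rw [Filter.mem_map, nhds_subtype, Filter.mem_comap] at hA
    obtain ⟨U, hU, hUA⟩ := hA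
    obtain ⟨L, hL⟩ := h.exists_hasStrictFDerivAt (hne x)
    have hmap := hL.map_nhds_eq_of_equiv
    have him : (fun y => ‖y‖ • N y) '' (U ∩ {0}ᶜ) ∈ 𝓝 (f x : ℝ³) := by
      have : (f x : ℝ³) = ‖(x : ℝ³)‖ • N x := by simp [f]
      rw [this, ← hmap]
      exact Filter.image_mem_map (Filter.inter_mem hU (isOpen_compl_singleton.mem_nhds (hne x)))
    rw [nhds_subtype, Filter.mem_comap]
    refine ⟨_, him, ?_⟩
    rintro y ⟨z, ⟨hzU, hz0⟩, hzy⟩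
    have hz1 : ‖z‖ = 1 := by
      have := congrArg norm hzy
      simpa [norm_smul, h.norm_normal z hz0] using this
    have : f ⟨z, by simpa using hz1⟩ = y := Subtype.ext (by simpa [f, hz1] using hzy)
    rw [← this]
    exact hUA hzU
  have hloc : IsLocalHomeomorph f := by
    rw [isLocalHomeomorph_iff_isOpenEmbedding_restrict]
    intro x
    obtain ⟨L, hL⟩ := h.exists_hasStrictFDerivAt (hne x)
    let e := hL.toOpenPartialHomeomorph (fun y => ‖y‖ • N y)
    refine ⟨Subtype.val ⁻¹' e.source, (e.open_source.preimage continuous_subtype_val).mem_nhds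
      hL.mem_toOpenPartialHomeomorph_source, ?_⟩
    refine .of_continuous_injective_isOpenMap (hf.comp continuous_subtype_val) ?_
      (hopen.domRestrict (e.open_source.preimage continuous_subtype_val))
    rintro ⟨y, hy⟩ ⟨z, hz⟩ hyz
    have : N y = N z := congrArg Subtype.val hyz
    exact Subtype.ext (Subtype.ext (e.injOn hy hz (by simp [e, this])))
  exact congrArg Subtype.val (hloc.injective_of_sphere
    (a₁ := ⟨x, by simpa using hx⟩) (a₂ := ⟨y, by simpa using hy⟩) (Subtype.ext hxy))

lemma IsConvexPair.eq_or_eq_neg_normal (h : IsConvexPair Φ N) {x n : ℝ³} (hx : x ≠ 0)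
    (hn : ‖n‖ = 1) (hnΦ : ∀ v, ⟪n, fderiv ℝ Φ x v⟫ = 0) : N x = n ∨ N x = -n := by
  obtain ⟨u, v, huv⟩ := exists_cross_eq x
  have hc := h.cross_ne_zero huv hx
  have hcc : ⟪cross (fderiv ℝ Φ x u) (fderiv ℝ Φ x v),
      cross (fderiv ℝ Φ x u) (fderiv ℝ Φ x v)⟫ ≠ (0 : ℝ) := by simpa using hc
  have key : ∀ w : ℝ³, (∀ v, ⟪w, fderiv ℝ Φ x v⟫ = 0) → ∃ s : ℝ,
      w = s • cross (fderiv ℝ Φ x u) (fderiv ℝ Φ x v) := by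
    intro w hw
    have h1 := inner_cross_smul_eq_dual (fderiv ℝ Φ x u) (fderiv ℝ Φ x v) w
    rw [hw, hw, zero_smul, zero_smul, sub_zero, zero_add, ← eq_inv_smul_iff₀ hcc, smul_smul] at h1
    exact ⟨_, h1⟩
  obtain ⟨s, hs⟩ := key n hnΦ
  obtain ⟨t, ht⟩ := key (N x) (h.inner_normal x hx)
  have hN := h.norm_normal x hx
  have hs0 : s ≠ 0 := by rintro rfl; simp [hs] at hn
  have e : N x = (t / s) • n := by rw [hs, smul_smul, div_mul_cancel₀ _ hs0, ht]
  rw [e, norm_smul, hn, mul_one, Real.norm_eq_abs] at hN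
  rcases eq_or_eq_neg_of_abs_eq hN with h' | h' <;> simp [e, h']

/-- A convex surface meets each of its tangent planes in a single point. -/
lemma IsConvexPair.inner_sub_normal_ne_zero (h : IsConvexPair Φ N) (hr : IsRadial Φ)
    {x p : ℝ³} (hx : ‖x‖ = 1) (hp : ‖p‖ = 1) (hxp : x ≠ p) : ⟪Φ x - Φ p, N x⟫ ≠ 0 := by
  have hne : ∀ {y : ℝ³}, ‖y‖ = 1 → y ≠ 0 := fun hy h0 => by simp [h0] at hy
  have hunit : ∀ {y : ℝ³}, y ≠ 0 → ‖‖y‖⁻¹ • y‖ = 1 := fun hy => by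
    rw [norm_smul, norm_inv, norm_norm, inv_mul_cancel₀ (norm_ne_zero_iff.2 hy)]
  have hn : ‖N x‖ = 1 := h.norm_normal x (hne hx)
  let f : ℝ³ → ℝ := fun y => ⟪Φ y, N x⟫
  let E : ℝ³ → Prop := fun y =>
    ‖y‖ = 1 ∧ ((∀ z, ‖z‖ = 1 → f z ≤ f y) ∨ (∀ z, ‖z‖ = 1 → f y ≤ f z))
  have hfr : ∀ y, y ≠ 0 → f (‖y‖⁻¹ • y) = f y := fun y hy => by simp only [f, hr y hy]
  have hcrit : ∀ y, E y → y = x ∨ N y = -N x := by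
    rintro y ⟨hy, hext⟩
    have hy0 := hne hy
    have hloc : IsLocalExtr f y := by
      rcases hext with hext | hext
      · refine Or.inr ?_
        filter_upwards [isOpen_ne.mem_nhds hy0] with z hz
        rw [← hfr z hz]
        exact hext _ (hunit hz)
      · refine Or.inl ?_
        filter_upwards [isOpen_ne.mem_nhds hy0] with z hz
        rw [← hfr z hz]
        exact hext _ (hunit hz)
    have hD := ((h.smooth.hasFDerivAt hy0).inner ℝ (hasFDerivAt_const (N x) y))
    have hz := hloc.hasFDerivAt_eq_zero hD
    refine (h.eq_or_eq_neg_normal hy0 hn fun v => ?_).imp (fun e => h.injective_normal hy hx e) id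
    have := congrArg (fun L => L v) hz
    rw [real_inner_comm]
    simpa [fderivInnerCLM_apply] using this
  have hneg : ∀ y z, E y → E z → y ≠ x → z ≠ x → y = z := fun y z hy hz hyx hzx =>
    h.injective_normal hy.1 hz.1 (((hcrit y hy).resolve_left hyx).trans
      ((hcrit z hz).resolve_left hzx).symm)
  have hcont : ContinuousOn f (sphere 0 1) := fun y hy =>
    ((h.smooth y (hne (by simpa using hy))).inner ℝ
      (contDiffAt_const (c := N x))).continuousAt.continuousWithinAt
  have hsne : (sphere (0 : ℝ³) 1).Nonempty := ⟨x, by simpa using hx⟩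
  obtain ⟨M, hM1, hM⟩ := (isCompact_sphere (0 : ℝ³) 1).exists_isMaxOn hsne hcont
  obtain ⟨m, hm1, hm⟩ := (isCompact_sphere (0 : ℝ³) 1).exists_isMinOn hsne hcont
  rw [mem_sphere_zero_iff_norm] at hM1 hm1
  replace hM : ∀ z, ‖z‖ = 1 → f z ≤ f M := fun z hz => hM (by simpa using hz)
  replace hm : ∀ z, ‖z‖ = 1 → f m ≤ f z := fun z hz => hm (by simpa using hz)
  have hEM : E M := ⟨hM1, Or.inl hM⟩
  have hEm : E m := ⟨hm1, Or.inr hm⟩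
  have hMm : f M ≠ f m := by
    intro he
    have hall : ∀ y, ‖y‖ = 1 → E y := fun y hy =>
      ⟨hy, Or.inl fun z hz => (hM z hz).trans (he.le.trans (hm y hy))⟩
    obtain ⟨q, hq, hxq⟩ := exists_norm_eq_one_inner_eq_zero x
    have hqx : ∀ s : ℝ, s • q ≠ x := by
      rintro s rfl
      simp only [inner_smul_left, real_inner_self_eq_norm_sq, hq] at hxq
      simp [norm_smul, hq] at hx hxq
      simp [hxq] at hx
    refine ne_neg_of_norm_eq_one hq (hneg q (-q) (hall q hq) (hall (-q) (by simpa using hq)) ?_ ?_)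
    · simpa using hqx 1
    · simpa using hqx (-1)
  intro h0
  have hfp : f p = f x := by
    rw [inner_sub_left, sub_eq_zero] at h0
    exact h0.symm
  by_cases hMx : M = x
  · have hmx : m ≠ x := by rintro rfl; exact hMm (by rw [hMx])
    have hEp : E p := ⟨hp, Or.inl fun z hz => (hM z hz).trans (by rw [hMx, hfp])⟩
    rw [← hneg p m hEp hEm hxp.symm hmx, hfp, hMx] at hMm
    exact hMm rfl
  · by_cases hmx : m = x
    · have hEp : E p := ⟨hp, Or.inr fun z hz => le_trans (by rw [hmx, hfp]) (hm z hz)⟩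
      rw [← hneg p M hEp hEM hxp.symm hMx, hfp, hmx] at hMm
      exact hMm rfl
    · exact hMm (by rw [hneg M m hEM hEm hMx hmx])

/-- The rotation field of an infinitesimal deformation of a convex surface is constant. -/
lemma IsRotation.fderiv_eq_zero {Ξ Y : ℝ³ → ℝ³} (hY : IsRotation Φ Ξ Y) (h : IsConvexPair Φ N)
    (hr : IsRadial Φ) (hrN : IsRadial N) {x₀ : ℝ³} (hx₀ : x₀ ≠ 0) : fderiv ℝ Y x₀ = 0 := by
  have hunit : ∀ {y : ℝ³}, y ≠ 0 → ‖‖y‖⁻¹ • y‖ = 1 := fun hy => by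
    rw [norm_smul, norm_inv, norm_norm, inv_mul_cancel₀ (norm_ne_zero_iff.2 hy)]
  have hpos : 0 < ‖x₀‖ := norm_pos_iff.2 hx₀
  have hp : ‖-(‖x₀‖⁻¹ • x₀)‖ = 1 := by rw [norm_neg, hunit hx₀]
  have hp0 : -(‖x₀‖⁻¹ • x₀) ≠ 0 := fun h0 => by simp [h0] at hp
  refine hY.fderiv_eq_zero_of_mem_rayCompl h (p := -(‖x₀‖⁻¹ • x₀)) (P := Φ (-(‖x₀‖⁻¹ • x₀)))
    hp0 ?_ ?_ ?_
  · intro x hx hxp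
    simp only [rayCompl, Set.mem_ofPred_eq, not_forall, not_not] at hxp
    obtain ⟨t, ht, rfl⟩ := hxp
    have ht0 : t ≠ 0 := by rintro rfl; simp at hx
    rw [← hr _ hx, norm_smul, hp, Real.norm_of_nonneg ht, mul_one, inv_smul_smul₀ ht0]
  · intro x hxp h0
    have hx := ne_zero_of_mem_rayCompl hxp
    obtain ⟨u, v, huv⟩ := exists_cross_eq x
    have hn := h.cross_ne_zero huv hx
    have e : cofactor (fderiv ℝ Φ x) x = cross (fderiv ℝ Φ x u) (fderiv ℝ Φ x v) := by
      nth_rw 2 [← huv]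
      rw [cofactor_cross]
    rw [e] at h0
    have h1 := inner_cross_smul_eq_dual (fderiv ℝ Φ x u) (fderiv ℝ Φ x v) (N x)
    rw [h.inner_normal x hx, h.inner_normal x hx] at h1
    have h2 := congrArg (fun z => ⟪Φ x - Φ (-(‖x₀‖⁻¹ • x₀)), z⟫) h1
    simp only [zero_smul, sub_zero, zero_add, inner_smul_right, h0, mul_zero] at h2
    have h3 := (mul_eq_zero.1 h2).resolve_left (by simpa using hn)
    refine h.inner_sub_normal_ne_zero hr (hunit hx) hp ?_ (by rwa [hr x hx, hrN x hx])
    intro he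
    exact hxp ‖x‖ (norm_nonneg x) (by rw [← he, smul_inv_smul₀ (norm_ne_zero_iff.2 hx)])
  · intro t ht he
    have h1 := congrArg (fun z => ⟪x₀, z⟫) he
    simp only [inner_smul_right, inner_neg_right, real_inner_self_eq_norm_sq] at h1
    have : 0 ≤ t * (‖x₀‖⁻¹ * ‖x₀‖ ^ 2) := by positivity
    have : 0 < ‖x₀‖ ^ 2 := by positivity
    linarith

end Visibility

section Radial

open scoped ContDiff Topology

/-- The radial projection of `ℝ³ ∖ {0}` onto the sphere, with a junk value at the origin. -/
def radial (x : ℝ³) : 𝕊² :=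
  if hx : x ≠ 0 then ⟨‖x‖⁻¹ • x, by simp [norm_smul, hx]⟩
  else ⟨EuclideanSpace.single 0 1, by simp⟩

lemma coe_radial {x : ℝ³} (hx : x ≠ 0) : (radial x : ℝ³) = ‖x‖⁻¹ • x := by
  simp [radial, hx]

lemma radial_coe (x : 𝕊²) : radial (x : ℝ³) = x := by
  apply Subtype.ext
  rw [coe_radial (ne_zero_of_mem_unit_sphere x)]
  simp

lemma isRadial_comp_radial (f : 𝕊² → ℝ³) : IsRadial (f ∘ radial) := by
  intro x hx
  have hr : ‖x‖⁻¹ • x = radial x := (coe_radial hx).symm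
  rw [Function.comp_apply, Function.comp_apply, hr, radial_coe]

lemma contMDiffAt_radial {x : ℝ³} (hx : x ≠ 0) : ContMDiffAt 𝓘(ℝ, ℝ³) (𝓡 2) ∞ radial x := by
  let U : TopologicalSpace.Opens ℝ³ := ⟨{0}ᶜ, isOpen_compl_singleton⟩
  have h1 : ContMDiff 𝓘(ℝ, ℝ³) 𝓘(ℝ, ℝ³) ∞ (fun y : U => ‖(y : ℝ³)‖⁻¹ • (y : ℝ³)) := by
    intro y
    have hy : (y : ℝ³) ≠ 0 := y.2
    refine (contMDiffAt_subtype_iff (f := fun z : ℝ³ => ‖z‖⁻¹ • z)).2 ?_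
    exact (((contDiffAt_norm ℝ hy).inv (norm_ne_zero_iff.2 hy)).smul contDiffAt_id).contMDiffAt
  have h2 : ∀ y : U, ‖(y : ℝ³)‖⁻¹ • (y : ℝ³) ∈ sphere (0 : ℝ³) 1 := fun y => by
    have hy : (y : ℝ³) ≠ 0 := y.2
    simp [norm_smul, hy]
  have h3 := (h1.codRestrict_sphere (n := 2) h2).contMDiffAt (x := ⟨x, hx⟩)
  have h4 : Set.codRestrict _ _ h2 = fun y : U => radial y := by
    ext1 y
    exact Subtype.ext (coe_radial y.2).symm
  rw [h4] at h3
  exact contMDiffAt_subtype_iff.1 h3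

variable {f : 𝕊² → ℝ³} {x : ℝ³}

lemma Smooth3.smoothOffZero (hf : Smooth3 f) : SmoothOffZero (f ∘ radial) := fun _ hx =>
  (hf.contMDiffAt.comp _ (contMDiffAt_radial hx)).contDiffAt

lemma Smooth3.fderiv_comp_radial (hf : Smooth3 f) (hx : x ≠ 0) (v : ℝ³) :
    fderiv ℝ (f ∘ radial) x v
      = mfd f (radial x) (mfderiv 𝓘(ℝ, ℝ³) (𝓡 2) radial x v) := by
  rw [← mfderiv_eq_fderiv, mfderiv_comp x (hf.contMDiffAt.mdifferentiableAt (by simp))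
    ((contMDiffAt_radial hx).mdifferentiableAt (by simp))]
  rfl

lemma exists_eq_smul_of_mfderiv_radial_eq_zero (hx : x ≠ 0) {v : ℝ³}
    (hv : mfderiv 𝓘(ℝ, ℝ³) (𝓡 2) radial x v = 0) : ∃ s : ℝ, v = s • x := by
  have hs : Smooth3 (fun y : 𝕊² => (y : ℝ³)) := contMDiff_coe_sphere
  have h1 := hs.fderiv_comp_radial hx v
  rw [hv, map_zero] at h1
  have h2 := ((contDiffAt_norm ℝ hx (n := 1)).differentiableAt (by simp)).hasFDerivAt.smul
    (hs.smoothOffZero.hasFDerivAt hx)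
  have h3 := h2.eq_of_eqOn_compl_zero (hasFDerivAt_id x) hx fun y hy => by
    simp [coe_radial hy, hy]
  have h4 := congrArg (fun L => L v) h3
  simp only [add_apply, smul_apply, ContinuousLinearMap.smulRight_apply, h1, smul_zero, zero_add,
    ContinuousLinearMap.id_apply, Function.comp_apply, coe_radial hx, smul_smul] at h4
  exact ⟨_, h4.symm⟩

lemma linearIndependent_mfderiv_radial {u v : ℝ³} (huv : cross u v = x) (hx : x ≠ 0) :
    LinearIndependent ℝ ![mfderiv 𝓘(ℝ, ℝ³) (𝓡 2) radial x u,
      mfderiv 𝓘(ℝ, ℝ³) (𝓡 2) radial x v] := by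
  rw [LinearIndependent.pair_iff]
  intro c d hcd
  let L : ℝ³ →L[ℝ] TangentSpace (𝓡 2) (radial x) := mfderiv 𝓘(ℝ, ℝ³) (𝓡 2) radial x
  have hL : L (c • u + d • v) = 0 := by
    rw [map_add, map_smul, map_smul]
    exact hcd
  obtain ⟨s, hs'⟩ := exists_eq_smul_of_mfderiv_radial_eq_zero hx hL
  have hcu : cross (c • u + d • v) v = c • x := by
    rw [← huv]
    apply ext_three <;> simp only [PiLp.add_apply, PiLp.smul_apply, smul_eq_mul,
      cross_apply_zero, cross_apply_one, cross_apply_two] <;> ring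
  have hdv : cross u (c • u + d • v) = d • x := by
    rw [← huv]
    apply ext_three <;> simp only [PiLp.add_apply, PiLp.smul_apply, smul_eq_mul,
      cross_apply_zero, cross_apply_one, cross_apply_two] <;> ring
  have hin : ⟪x, c • u + d • v⟫ = 0 := by
    rw [← huv]
    simp only [inner_eq_sum_three, PiLp.add_apply, PiLp.smul_apply, smul_eq_mul,
      cross_apply_zero, cross_apply_one, cross_apply_two]
    ring
  rw [hs', inner_smul_right] at hin
  have hs0 : s = 0 := (mul_eq_zero.1 hin).resolve_right (by simpa using hx)
  rw [hs', hs0, zero_smul] at hcu hdv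
  rw [cross_zero_left] at hcu
  rw [cross_zero_right] at hdv
  exact ⟨(smul_eq_zero.1 hcu.symm).resolve_right hx, (smul_eq_zero.1 hdv.symm).resolve_right hx⟩

lemma isConvexPair_comp_radial {φ ν : 𝕊² → ℝ³} (hφ : Smooth3 φ) (hν : IsUnitNormalField φ ν)
    (hK : PosGaussCurvature φ ν) : IsConvexPair (φ ∘ radial) (ν ∘ radial) where
  smooth := hφ.smoothOffZero
  smooth_normal := hν.1.smoothOffZero
  fderiv_self _ hx := (isRadial_comp_radial φ).fderiv_self hφ.smoothOffZero hx
  norm_normal _ _ := hν.2.1 _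
  inner_normal x hx v := by
    rw [hφ.fderiv_comp_radial hx]
    exact hν.2.2 _ _
  pos u v huv := by
    simp only [hφ.fderiv_comp_radial huv, hν.1.fderiv_comp_radial huv]
    exact hK _ _ _ (linearIndependent_mfderiv_radial rfl huv)

end Radial

/-- **Liebmann–Blaschke–Weyl infinitesimal rigidity** of strictly convex smooth closed
surfaces: every isometric infinitesimal deformation is trivial. -/
theorem liebmann_blaschke_weyl_infinitesimal_rigidity (φ ν ξ : 𝕊² → ℝ³)
    (hφ : Smooth3 φ) (hφinj : Function.Injective φ)
    (hφimm : ∀ x : 𝕊², Function.Injective (mfd φ x))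
    (hν : IsUnitNormalField φ ν)
    (hK : PosGaussCurvature φ ν)
    (hξ : IsIsometricDeformation φ ξ) :
    ∃ a b : ℝ³, ∀ x : 𝕊², ξ x = cross a (φ x) + b := by
  have h := isConvexPair_comp_radial hφ hν hK
  have hξ0 := hξ.1.smoothOffZero
  obtain ⟨Y, hY⟩ := h.exists_isRotation hξ0
    (fun x hx => (isRadial_comp_radial ξ).fderiv_self hξ0 hx) (fun x hx u v => by
      simp only [hφ.fderiv_comp_radial hx, hξ.1.fderiv_comp_radial hx]
      exact hξ.2 _ _ _)
  obtain ⟨a, b, hab⟩ := hY.exists_eq_cross_add h.smooth fun x hx =>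
    hY.fderiv_eq_zero h (isRadial_comp_radial φ) (isRadial_comp_radial ν) hx
  refine ⟨a, b, fun x => ?_⟩
  simpa [radial_coe] using hab x (ne_zero_of_mem_unit_sphere x)
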